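/- arXiv:2505.08753 — 2 statements merged into one kernel-verified Lean document; each statement's English description precedes it below -/
import Mathlib

section
/- For every real p ≥ 2 and all vectors a, b ∈ ℝ^N, one has | |a|^{p/2} − |b|^{p/2} | ≤ | |a|^{(p−2)/2} a − |b|^{(p−2)/2} b |. -/
/-- Multiplying `a` by `‖a‖ ^ (r - 1)` gives a vector of norm `‖a‖ ^ r`. -/
theorem norm_rpow_sub_one_smul_self {E : Type*} [NormedAddCommGroup E] [NormedSpace ℝ E]
    {r : ℝ} (hr : r ≠ 0) (a : E) : ‖‖a‖ ^ (r - 1) • a‖ = ‖a‖ ^ r := by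
  rcases eq_or_ne a 0 with rfl | ha
  · simp [Real.zero_rpow hr]
  · rw [norm_smul, Real.norm_of_nonneg (by positivity), Real.rpow_sub_one (norm_ne_zero_iff.2 ha),
      div_mul_cancel₀ _ (norm_ne_zero_iff.2 ha)]

/-- For `p ≥ 2` and all `a, b ∈ ℝ^N`:
`| |a|^{p/2} − |b|^{p/2} | ≤ | |a|^{(p−2)/2} a − |b|^{(p−2)/2} b |`. -/
theorem norm_rpow_sub_le (N : ℕ) (hN : 1 ≤ N) (p : ℝ) (hp : 2 ≤ p)
    (a b : EuclideanSpace ℝ (Fin N)) :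
    |‖a‖ ^ (p / 2) - ‖b‖ ^ (p / 2)| ≤
      ‖‖a‖ ^ ((p - 2) / 2) • a - ‖b‖ ^ ((p - 2) / 2) • b‖ := by
  have hr : p / 2 ≠ 0 := by positivity
  rw [show (p - 2) / 2 = p / 2 - 1 by ring, ← norm_rpow_sub_one_smul_self hr a,
    ← norm_rpow_sub_one_smul_self hr b]
  exact abs_norm_sub_norm_le _ _
end

section
/- Let Ω ⊂ ℝ^N be a measurable set of finite Lebesgue measure |Ω|, let M > 0, let k, s ≥ 1 be reals, and let u, v : Ω → ℝ be measurable functions with 0 ≤ u(x) ≤ M and 0 ≤ v(x) ≤ M for a.e. x ∈ Ω. Set φ(x) = max(u(x) − v(x), 0). Then ∫_Ω ( u(x)^k ∫_Ω u(y)^s dy − v(x)^k ∫_Ω v(y)^s dy ) φ(x) dx ≤ (k + s) · |Ω| · M^{k+s−1} · ∫_Ω φ(x)² dx. -/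
open MeasureTheory

/-- A quantitative one-sided Lipschitz bound for `t ↦ t ^ p` on `[0, M]`, `p ≥ 1`. -/
theorem rpow_sub_rpow_le_mul_max {a b M p : ℝ} (ha : 0 ≤ a) (hb : 0 ≤ b) (haM : a ≤ M)
    (hp : 1 ≤ p) : a ^ p - b ^ p ≤ p * M ^ (p - 1) * max (a - b) 0 := by
  have hM : 0 ≤ M := ha.trans haM
  rcases le_or_gt a b with hab | hab
  · have h1 : a ^ p ≤ b ^ p := Real.rpow_le_rpow ha hab (by linarith)
    have h2 : 0 ≤ p * M ^ (p - 1) * max (a - b) 0 := by positivity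
    linarith
  · have ha0 : 0 < a := hb.trans_lt hab
    rw [max_eq_left (by linarith)]
    have h1 : 1 + p * (b / a - 1) ≤ (1 + (b / a - 1)) ^ p :=
      one_add_mul_self_le_rpow_one_add (by linarith [div_nonneg hb ha]) hp
    rw [add_sub_cancel, Real.div_rpow hb ha, le_div_iff₀ (by positivity)] at h1
    have h2 : a ^ p = a ^ (p - 1) * a := by
      rw [← Real.rpow_add_one ha0.ne', sub_add_cancel]
    have h3 : (1 + p * (b / a - 1)) * a ^ p = a ^ p - p * a ^ (p - 1) * (a - b) := by
      rw [h2]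
      field_simp
      ring
    have h4 : p * a ^ (p - 1) * (a - b) ≤ p * M ^ (p - 1) * (a - b) := by
      have : 0 ≤ a - b := by linarith
      gcongr
    linarith

/-- The Cauchy–Schwarz inequality against the constant function `1`. -/
theorem sq_integral_le_measureReal_mul_integral_sq {X : Type*} [MeasurableSpace X]
    {μ : Measure X} [IsFiniteMeasure μ] {f : X → ℝ} (hf : Integrable f μ)
    (hf2 : Integrable (fun x => f x ^ 2) μ) :
    (∫ x, f x ∂μ) ^ 2 ≤ μ.real Set.univ * ∫ x, f x ^ 2 ∂μ := by
  set m := μ.real Set.univ with hm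
  set I := ∫ x, f x ∂μ with hI
  rcases eq_or_lt_of_le (measureReal_nonneg : 0 ≤ m) with h0 | h0
  · have hμ : μ = 0 := by
      rw [← Measure.measure_univ_eq_zero]
      exact (measureReal_eq_zero_iff).1 h0.symm
    simp [hI, hμ]
  · have h1 : 0 ≤ ∫ x, (m * f x - I) ^ 2 ∂μ := integral_nonneg fun x => sq_nonneg _
    have h2 : ∫ x, (m * f x - I) ^ 2 ∂μ = m * (m * (∫ x, f x ^ 2 ∂μ) - I ^ 2) := by
      have h3 : ∀ x, (m * f x - I) ^ 2 = m ^ 2 * f x ^ 2 - 2 * m * I * f x + I ^ 2 :=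
        fun x => by ring
      simp_rw [h3]
      have h4 : Integrable (fun x => m ^ 2 * f x ^ 2 - 2 * m * I * f x) μ :=
        (hf2.const_mul _).sub (hf.const_mul _)
      rw [integral_add h4 (integrable_const _),
        integral_sub (hf2.const_mul _) (hf.const_mul _), integral_const_mul,
        integral_const_mul, integral_const, smul_eq_mul, ← hm, ← hI]
      ring
    rw [h2] at h1
    linarith [nonneg_of_mul_nonneg_right h1 h0]

/-- The nonlocal source estimate over an arbitrary finite measure. -/
theorem integral_nonlocal_source_le {X : Type*} [MeasurableSpace X]
    {μ : Measure X} [IsFiniteMeasure μ] {M k s : ℝ} (hM : 0 < M) (hk : 1 ≤ k) (hs : 1 ≤ s)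
    {u v : X → ℝ} (hu : Measurable u) (hv : Measurable v)
    (hub : ∀ᵐ x ∂μ, 0 ≤ u x ∧ u x ≤ M) (hvb : ∀ᵐ x ∂μ, 0 ≤ v x ∧ v x ≤ M) :
    ∫ x, (u x ^ k * (∫ y, u y ^ s ∂μ) - v x ^ k * (∫ y, v y ^ s ∂μ)) * max (u x - v x) 0 ∂μ
      ≤ (k + s) * μ.real Set.univ * M ^ (k + s - 1) * ∫ x, (max (u x - v x) 0) ^ 2 ∂μ := by
  have hpow {w : X → ℝ} (hw : Measurable w) (hwb : ∀ᵐ x ∂μ, 0 ≤ w x ∧ w x ≤ M) {p : ℝ}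
      (hp : 1 ≤ p) : Integrable (fun x => w x ^ p) μ := by
    refine Integrable.of_bound (hw.pow_const p).aestronglyMeasurable (M ^ p) ?_
    filter_upwards [hwb] with x hx
    rw [Real.norm_of_nonneg (Real.rpow_nonneg hx.1 _)]
    exact Real.rpow_le_rpow hx.1 hx.2 (by linarith)
  have hφm : Measurable fun x => max (u x - v x) 0 := (hu.sub hv).max measurable_const
  have hφb : ∀ᵐ x ∂μ, ‖max (u x - v x) 0‖ ≤ M := by
    filter_upwards [hub, hvb] with x hx hy
    rw [Real.norm_of_nonneg (le_max_right _ _)]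
    exact max_le (by linarith) hM.le
  have hφ : Integrable (fun x => max (u x - v x) 0) μ :=
    Integrable.of_bound hφm.aestronglyMeasurable M hφb
  have hφ2 : Integrable (fun x => (max (u x - v x) 0) ^ 2) μ := by
    simp_rw [pow_two]
    exact hφ.bdd_mul hφm.aestronglyMeasurable hφb
  have hCS := sq_integral_le_measureReal_mul_integral_sq hφ hφ2
  set m := μ.real Set.univ with hm
  set I := ∫ x, max (u x - v x) 0 ∂μ with hI
  set J := ∫ x, (max (u x - v x) 0) ^ 2 ∂μ with hJ
  set U := ∫ y, u y ^ s ∂μ with hU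
  set V := ∫ y, v y ^ s ∂μ with hV
  have hI0 : 0 ≤ I := integral_nonneg fun x => le_max_right _ _
  have hU0 : 0 ≤ U := integral_nonneg_of_ae <| by
    filter_upwards [hub] with x hx using Real.rpow_nonneg hx.1 _
  have hUM : U ≤ m * M ^ s := by
    have h : U ≤ ∫ _, M ^ s ∂μ := integral_mono_ae (hpow hu hub hs) (integrable_const _) <| by
      filter_upwards [hub] with x hx using Real.rpow_le_rpow hx.1 hx.2 (by linarith)
    rwa [integral_const, smul_eq_mul] at h
  have hUV : U - V ≤ s * M ^ (s - 1) * I := by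
    rw [hU, hV, hI, ← integral_sub (hpow hu hub hs) (hpow hv hvb hs), ← integral_const_mul]
    refine integral_mono_ae ((hpow hu hub hs).sub (hpow hv hvb hs)) (hφ.const_mul _) ?_
    filter_upwards [hub, hvb] with x hx hy using
      rpow_sub_rpow_le_mul_max hx.1 hy.1 hx.2 hs
  have hks : M ^ (k - 1) * M ^ s = M ^ (k + s - 1) := by
    rw [← Real.rpow_add hM]; congr 1; ring
  have hsk : M ^ k * M ^ (s - 1) = M ^ (k + s - 1) := by
    rw [← Real.rpow_add hM]; congr 1; ring
  have hbound : ∀ᵐ x ∂μ, (u x ^ k * U - v x ^ k * V) * max (u x - v x) 0 ≤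
      k * m * M ^ (k + s - 1) * (max (u x - v x) 0) ^ 2
        + s * M ^ (k + s - 1) * I * max (u x - v x) 0 := by
    filter_upwards [hub, hvb] with x hx hy
    have h1 := rpow_sub_rpow_le_mul_max hx.1 hy.1 hx.2 hk
    have hφ0 : 0 ≤ max (u x - v x) 0 := le_max_right _ _
    have hvk0 : 0 ≤ v x ^ k := Real.rpow_nonneg hy.1 _
    have hvkM : v x ^ k ≤ M ^ k := Real.rpow_le_rpow hy.1 hy.2 (by linarith)
    set φ := max (u x - v x) 0
    have h2 : (u x ^ k - v x ^ k) * U ≤ k * M ^ (k - 1) * φ * (m * M ^ s) :=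
      (mul_le_mul_of_nonneg_right h1 hU0).trans
        (mul_le_mul_of_nonneg_left hUM (by positivity))
    have h3 : v x ^ k * (U - V) ≤ M ^ k * (s * M ^ (s - 1) * I) :=
      (mul_le_mul_of_nonneg_left hUV hvk0).trans
        (mul_le_mul_of_nonneg_right hvkM (by positivity))
    calc (u x ^ k * U - v x ^ k * V) * φ
        = ((u x ^ k - v x ^ k) * U + v x ^ k * (U - V)) * φ := by ring
      _ ≤ (k * M ^ (k - 1) * φ * (m * M ^ s) + M ^ k * (s * M ^ (s - 1) * I)) * φ := by
          gcongr
      _ = k * m * (M ^ (k - 1) * M ^ s) * φ ^ 2 + s * (M ^ k * M ^ (s - 1)) * I * φ := by ring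
      _ = _ := by rw [hks, hsk]
  have hint : Integrable (fun x => (u x ^ k * U - v x ^ k * V) * max (u x - v x) 0) μ :=
    (((hpow hu hub hk).mul_const U).sub ((hpow hv hvb hk).mul_const V)).mul_bdd
      hφm.aestronglyMeasurable hφb
  calc _ ≤ ∫ x, (k * m * M ^ (k + s - 1) * (max (u x - v x) 0) ^ 2
        + s * M ^ (k + s - 1) * I * max (u x - v x) 0) ∂μ :=
        integral_mono_ae hint ((hφ2.const_mul _).add (hφ.const_mul _)) hbound
    _ = k * m * M ^ (k + s - 1) * J + s * M ^ (k + s - 1) * I ^ 2 := by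
        rw [integral_add (hφ2.const_mul _) (hφ.const_mul _), integral_const_mul,
          integral_const_mul, ← hI, ← hJ]
        ring
    _ ≤ k * m * M ^ (k + s - 1) * J + s * M ^ (k + s - 1) * (m * J) := by gcongr
    _ = _ := by ring

/-- Estimate of the nonlocal source term `B = α D₁ + α D₂` in the proof of the comparison
principle: if `0 ≤ u, v ≤ M` a.e. on a set `Ω ⊆ ℝ^N` of finite measure, `k, s ≥ 1`, and
`φ = max(u − v, 0)`, then
`∫_Ω (u^k ∫_Ω u^s − v^k ∫_Ω v^s) φ ≤ (k+s) |Ω| M^{k+s−1} ∫_Ω φ²`. -/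
theorem nonlocal_source_estimate (N : ℕ) (hN : 1 ≤ N)
    (Ω : Set (EuclideanSpace ℝ (Fin N))) (hΩ : MeasurableSet Ω)
    (hΩfin : volume Ω ≠ ⊤)
    (M k s : ℝ) (hM : 0 < M) (hk : 1 ≤ k) (hs : 1 ≤ s)
    (u v : EuclideanSpace ℝ (Fin N) → ℝ) (hu : Measurable u) (hv : Measurable v)
    (hub : ∀ᵐ x ∂(volume.restrict Ω), 0 ≤ u x ∧ u x ≤ M)
    (hvb : ∀ᵐ x ∂(volume.restrict Ω), 0 ≤ v x ∧ v x ≤ M) :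
    ∫ x in Ω, (u x ^ k * (∫ y in Ω, u y ^ s) - v x ^ k * (∫ y in Ω, v y ^ s)) *
        max (u x - v x) 0
      ≤ (k + s) * (volume Ω).toReal * M ^ (k + s - 1) *
        ∫ x in Ω, (max (u x - v x) 0) ^ 2 := by
  have : IsFiniteMeasure (volume.restrict Ω) := isFiniteMeasure_restrict.2 hΩfin
  have h := integral_nonlocal_source_le hM hk hs hu hv hub hvb
  rwa [measureReal_restrict_apply_univ] at h
end
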